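/- For every correlation coefficient ρ with 0 < ρ² < 1, the function (R_u, R_v) ↦ 𝓡(R_u,R_v,ρ) is strictly increasing in each of the two variables R_u > 0 and R_v > 0. -/

import Mathlib

/-- The achievable secret key rate in the two-terminal Gaussian model where terminal `u`
(quantization rate `Ru`) communicates publicly and terminal `v` (quantization rate `Rv`)
stays silent, with correlation coefficient `ρ` between the two sources. -/
noncomputable def skRate (Ru Rv ρ : ℝ) : ℝ :=
  (1 / 2) * Real.log (Real.exp (2 * Ru) /
    ((Real.exp (2 * Ru) - 1) * (1 - ρ ^ 2) + 1 +
      ρ ^ 2 * Real.exp (2 * Ru) / (Real.exp (2 * Rv) - 1)))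

theorem exp_two_mul_sub_one_pos {R : ℝ} (hR : 0 < R) : 0 < Real.exp (2 * R) - 1 :=
  sub_pos.mpr (Real.one_lt_exp_iff.mpr (by linarith))

theorem skRate_eq_neg_log {Ru Rv ρ : ℝ} (hRv : 0 < Rv) :
    skRate Ru Rv ρ = -((1 / 2) * Real.log
      (1 - ρ ^ 2 + ρ ^ 2 / Real.exp (2 * Ru) + ρ ^ 2 / (Real.exp (2 * Rv) - 1))) := by
  have ha := Real.exp_pos (2 * Ru)
  have hb := exp_two_mul_sub_one_pos hRv
  have key : (Real.exp (2 * Ru) - 1) * (1 - ρ ^ 2) + 1 +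
      ρ ^ 2 * Real.exp (2 * Ru) / (Real.exp (2 * Rv) - 1) =
      Real.exp (2 * Ru) *
        (1 - ρ ^ 2 + ρ ^ 2 / Real.exp (2 * Ru) + ρ ^ 2 / (Real.exp (2 * Rv) - 1)) := by
    field_simp
    ring
  rw [skRate, key, div_mul_cancel_left₀ ha.ne', Real.log_inv, mul_neg]

/-- `skRate` is strictly increasing in each of the two rate variables on `(0, ∞)`. -/
theorem skRate_strictMonoOn (ρ : ℝ) (hρ0 : 0 < ρ ^ 2) (hρ1 : ρ ^ 2 < 1) :
    (∀ Rv : ℝ, 0 < Rv → StrictMonoOn (fun Ru : ℝ => skRate Ru Rv ρ) (Set.Ioi 0)) ∧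
      (∀ Ru : ℝ, 0 < Ru → StrictMonoOn (fun Rv : ℝ => skRate Ru Rv ρ) (Set.Ioi 0)) := by
  have hpos : 0 < 1 - ρ ^ 2 := sub_pos.mpr hρ1
  constructor
  · intro Rv hRv x _ y _ hxy
    have hb := exp_two_mul_sub_one_pos hRv
    simp only [skRate_eq_neg_log hRv]
    gcongr
  · intro Ru _ x hx y hy hxy
    have hbx := exp_two_mul_sub_one_pos hx
    have hby := exp_two_mul_sub_one_pos hy
    simp only [skRate_eq_neg_log hx, skRate_eq_neg_log hy]
    gcongr
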